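/- arXiv:1706.09111 — 3 statements merged into one kernel-verified Lean document; each statement's English description precedes it below -/
import Mathlib

section
/- Let α₁, α₂ ∈ ℝ with α₁ ≠ 0 and 2α₂/(3α₁) ∉ ℤ. Then for all integers k₁, k₂, k₃, one has Φ(k₁,k₂,k₃) = 0 if and only if (k₁+k₂)(k₂+k₃) = 0. -/
open scoped ENNReal

/-- Japanese bracket `⟨x⟩ = 1 + |x|`. -/
noncomputable def jap (x : ℝ) : ℝ := 1 + |x|

/-- The resonance function `Φ(k₁,k₂,k₃)` of the third order dispersion
relation `k ↦ α₁k³ + α₂k²`. -/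
noncomputable def resPhi (α₁ α₂ : ℝ) (k₁ k₂ k₃ : ℤ) : ℝ :=
  (α₁ * ((k₁ : ℝ) + k₂ + k₃) ^ 3 + α₂ * ((k₁ : ℝ) + k₂ + k₃) ^ 2) -
    (α₁ * (k₁ : ℝ) ^ 3 + α₂ * (k₁ : ℝ) ^ 2) +
    (α₁ * (-(k₂ : ℝ)) ^ 3 + α₂ * (-(k₂ : ℝ)) ^ 2) -
    (α₁ * (k₃ : ℝ) ^ 3 + α₂ * (k₃ : ℝ) ^ 2)

/-- Factorization of the resonance function. -/
theorem resPhi_eq_mul {α₁ : ℝ} (α₂ : ℝ) (hα₁ : α₁ ≠ 0) (k₁ k₂ k₃ : ℤ) :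
    resPhi α₁ α₂ k₁ k₂ k₃ =
      3 * α₁ * (((k₁ + k₂) * (k₂ + k₃) : ℤ) : ℝ) * (k₃ + k₁ + 2 * α₂ / (3 * α₁)) := by
  unfold resPhi
  push_cast
  field_simp
  ring

/-- Characterization of resonances (2.8) / `cond:Phi=0`. -/
theorem stmt12 (α₁ α₂ : ℝ) (hα₁ : α₁ ≠ 0)
    (hres : ∀ n : ℤ, 2 * α₂ / (3 * α₁) ≠ (n : ℝ)) (k₁ k₂ k₃ : ℤ) :
    resPhi α₁ α₂ k₁ k₂ k₃ = 0 ↔ (k₁ + k₂) * (k₂ + k₃) = 0 := by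
  have hne : (k₃ : ℝ) + k₁ + 2 * α₂ / (3 * α₁) ≠ 0 := by
    intro h
    apply hres (-(k₃ + k₁))
    push_cast
    linarith
  rw [resPhi_eq_mul α₂ hα₁, mul_eq_zero_iff_right hne,
    mul_eq_zero_iff_left (mul_ne_zero three_ne_zero hα₁), Int.cast_eq_zero]
end

section
/- For every ε > 0 there exists a constant C > 0 such that for all sequences f₁, f₂, f₃ : ℤ → [0,∞), sup_{k∈ℤ} ∑_{k₁+k₂+k₃=k} f₁(k₁)·f₂(k₂)·f₃(k₃)/⟨k₁+k₂⟩ ≤ C·(∑_{k∈ℤ} f₁(k)²)^{1/2}·(∑_{k∈ℤ} ⟨k⟩^{2ε} f₂(k)²)^{1/2}·sup_{k∈ℤ} f₃(k), where the sum on the left is over all triples (k₁,k₂,k₃) ∈ ℤ³ with k₁+k₂+k₃ = k. -/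
open scoped ENNReal

theorem one_le_jap (x : ℝ) : 1 ≤ jap x := by
  unfold jap
  linarith [abs_nonneg x]

/-- The Cauchy–Schwarz inequality for extended nonnegative series. -/
theorem ENNReal.tsum_mul_le_sqrt_mul_sqrt {ι : Type*} (f g : ι → ℝ≥0∞) :
    ∑' i, f i * g i ≤ (∑' i, f i ^ 2) ^ (1 / 2 : ℝ) * (∑' i, g i ^ 2) ^ (1 / 2 : ℝ) := by
  let _ : MeasurableSpace ι := ⊤
  have h := ENNReal.lintegral_mul_le_Lp_mul_Lq (MeasureTheory.Measure.count : MeasureTheory.Measure ι)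
    Real.HolderConjugate.two_two (f := f) (g := g)
    measurable_from_top.aemeasurable measurable_from_top.aemeasurable
  simpa [MeasureTheory.lintegral_count] using h

theorem summable_jap_rpow {s : ℝ} (hs : 1 < s) : Summable fun n : ℤ => jap (n : ℝ) ^ (-s) := by
  refine Summable.of_norm_bounded_eventually (Real.summable_abs_int_rpow hs) ?_
  have h0 : ({0} : Set ℤ).Finite := Set.finite_singleton 0
  filter_upwards [h0.compl_mem_cofinite] with n hn
  have hn' : (0 : ℝ) < |(n : ℝ)| := by
    rw [abs_pos]
    exact_mod_cast hn
  rw [Real.norm_of_nonneg (Real.rpow_nonneg (zero_le_one.trans (one_le_jap _)) _)]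
  exact Real.rpow_le_rpow_of_nonpos hn' (by unfold jap; linarith) (by linarith)

/-- The pointwise kernel bound behind the trilinear estimate. -/
theorem inv_le_max_rpow_mul {x y δ : ℝ} (hx : 1 ≤ x) (hy : 1 ≤ y) (hδ : 0 < δ) (hδ1 : δ ≤ 1) :
    x⁻¹ ≤ max (y ^ (-((1 + δ) / 2))) (x ^ (-((1 + δ) / 2))) *
      (x ^ (-((1 + δ) / 2)) * y ^ δ) := by
  have hx0 : 0 < x := by linarith
  have hy0 : 0 < y := by linarith
  have hxp : x⁻¹ = x ^ (-((1 + δ) / 2)) * (x ^ (-((1 + δ) / 2)) * x ^ δ) := by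
    rw [← Real.rpow_add hx0, ← Real.rpow_add hx0, ← Real.rpow_neg_one]
    congr 1
    ring
  rcases le_total x y with h | h
  · rw [hxp]
    gcongr
    exact le_max_right _ _
  · have hsplit : x⁻¹ = x ^ (-((1 - δ) / 2)) * x ^ (-((1 + δ) / 2)) := by
      rw [← Real.rpow_add hx0, ← Real.rpow_neg_one]
      congr 1
      ring
    have hyp : y ^ (-((1 - δ) / 2)) = y ^ (-((1 + δ) / 2)) * y ^ δ := by
      rw [← Real.rpow_add hy0]
      congr 1
      ring
    calc x⁻¹ = x ^ (-((1 - δ) / 2)) * x ^ (-((1 + δ) / 2)) := hsplit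
      _ ≤ y ^ (-((1 - δ) / 2)) * x ^ (-((1 + δ) / 2)) := by
        gcongr ?_ * _
        exact Real.rpow_le_rpow_of_nonpos hy0 h (by linarith)
      _ = y ^ (-((1 + δ) / 2)) * (x ^ (-((1 + δ) / 2)) * y ^ δ) := by rw [hyp]; ring
      _ ≤ _ := by
        gcongr
        exact le_max_left _ _

/-- Schur-type bound for a bilinear form on `ℤ` whose kernel is controlled by a square-summable
weight `w` of one variable and of the sum of both variables. -/
theorem tsum_mul_max_mul_le (w f g : ℤ → ℝ≥0∞) :
    ∑' p : ℤ × ℤ, (f p.1 * max (w p.2) (w (p.1 + p.2))) * (g p.2 * w (p.1 + p.2)) ≤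
      2 * (∑' n, w n ^ 2) * (∑' n, f n ^ 2) ^ (1 / 2 : ℝ) * (∑' n, g n ^ 2) ^ (1 / 2 : ℝ) := by
  set Z := ∑' n, w n ^ 2 with hZ
  have hmax (a b : ℝ≥0∞) : max a b ^ 2 ≤ a ^ 2 + b ^ 2 := by
    rcases le_total a b with h | h
    · simp [max_eq_right h]
    · simp [max_eq_left h]
  have hl (a : ℤ) : ∑' b, w (a + b) ^ 2 = Z := (Equiv.addLeft a).tsum_eq fun n => w n ^ 2
  have hr (b : ℤ) : ∑' a, w (a + b) ^ 2 = Z := (Equiv.addRight b).tsum_eq fun n => w n ^ 2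
  have h1 : ∑' p : ℤ × ℤ, (f p.1 * max (w p.2) (w (p.1 + p.2))) ^ 2 ≤
      2 * Z * ∑' n, f n ^ 2 := by
    rw [ENNReal.tsum_prod', ← ENNReal.tsum_mul_left]
    refine ENNReal.tsum_le_tsum fun a => ?_
    simp only [mul_pow, ENNReal.tsum_mul_left]
    rw [mul_comm]
    gcongr
    calc ∑' b, max (w b) (w (a + b)) ^ 2 ≤ ∑' b, (w b ^ 2 + w (a + b) ^ 2) :=
          ENNReal.tsum_le_tsum fun b => hmax _ _
      _ = 2 * Z := by rw [ENNReal.tsum_add, hl, ← hZ, two_mul]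
  have h2 : ∑' p : ℤ × ℤ, (g p.2 * w (p.1 + p.2)) ^ 2 ≤ 2 * Z * ∑' n, g n ^ 2 := by
    rw [ENNReal.tsum_prod', ENNReal.tsum_comm, ← ENNReal.tsum_mul_left]
    refine ENNReal.tsum_le_tsum fun b => ?_
    simp only [mul_pow, ENNReal.tsum_mul_left]
    rw [mul_comm, hr]
    gcongr
    rw [two_mul]
    exact le_self_add
  have hsq : (2 * Z) ^ (1 / 2 : ℝ) * (2 * Z) ^ (1 / 2 : ℝ) = 2 * Z := by
    rw [← ENNReal.rpow_add_of_nonneg _ _ (by norm_num) (by norm_num)]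
    norm_num
  calc _ ≤ _ := ENNReal.tsum_mul_le_sqrt_mul_sqrt _ _
    _ ≤ (2 * Z * ∑' n, f n ^ 2) ^ (1 / 2 : ℝ) * (2 * Z * ∑' n, g n ^ 2) ^ (1 / 2 : ℝ) := by
      gcongr
    _ = ((2 * Z) ^ (1 / 2 : ℝ) * (2 * Z) ^ (1 / 2 : ℝ)) * (∑' n, f n ^ 2) ^ (1 / 2 : ℝ) *
        (∑' n, g n ^ 2) ^ (1 / 2 : ℝ) := by
      rw [ENNReal.mul_rpow_of_nonneg (2 * Z) (∑' n, f n ^ 2) (by norm_num),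
        ENNReal.mul_rpow_of_nonneg (2 * Z) (∑' n, g n ^ 2) (by norm_num)]
      ring
    _ = _ := by rw [hsq]

/-- The trilinear convolution estimate (3.8) / `est:H'a`. -/
theorem stmt16 (ε : ℝ) (hε : 0 < ε) :
    ∃ C : ℝ, 0 < C ∧ ∀ f₁ f₂ f₃ : ℤ → ℝ≥0∞,
      (⨆ k : ℤ, ∑' p : ℤ × ℤ,
          f₁ p.1 * f₂ p.2 * f₃ (k - p.1 - p.2) / ENNReal.ofReal (jap ((p.1 : ℝ) + p.2))) ≤
        ENNReal.ofReal C * (∑' k : ℤ, f₁ k ^ 2) ^ (1 / 2 : ℝ) *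
          (∑' k : ℤ, ENNReal.ofReal (jap (k : ℝ) ^ (2 * ε)) * f₂ k ^ 2) ^ (1 / 2 : ℝ) *
          ⨆ k : ℤ, f₃ k := by
  obtain ⟨δ, hδ, hδ1, hδε⟩ : ∃ δ : ℝ, 0 < δ ∧ δ ≤ 1 ∧ δ ≤ ε :=
    ⟨min ε 1, lt_min hε one_pos, min_le_right _ _, min_le_left _ _⟩
  have hpos (x : ℝ) : 0 < jap x := one_pos.trans_le (one_le_jap x)
  have hsum := summable_jap_rpow (s := 1 + δ) (by linarith)
  let w : ℤ → ℝ≥0∞ := fun n => ENNReal.ofReal (jap (n : ℝ) ^ (-((1 + δ) / 2)))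
  let v : ℤ → ℝ≥0∞ := fun n => ENNReal.ofReal (jap (n : ℝ) ^ δ)
  have hw : ∑' n, w n ^ 2 = ENNReal.ofReal (∑' n : ℤ, jap (n : ℝ) ^ (-(1 + δ))) := by
    rw [ENNReal.ofReal_tsum_of_nonneg (fun n => Real.rpow_nonneg (hpos _).le _) hsum]
    refine tsum_congr fun n => ?_
    rw [← ENNReal.ofReal_pow (Real.rpow_nonneg (hpos _).le _), ← Real.rpow_mul_natCast (hpos _).le]
    congr 2
    push_cast
    ring
  refine ⟨2 * ∑' n : ℤ, jap (n : ℝ) ^ (-(1 + δ)), ?_, fun f₁ f₂ f₃ => iSup_le fun k => ?_⟩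
  · exact mul_pos two_pos
      (hsum.tsum_pos (fun n => Real.rpow_nonneg (hpos _).le _) 0 (Real.rpow_pos_of_pos (hpos _) _))
  have hker (a b : ℤ) : (ENNReal.ofReal (jap ((a : ℝ) + b)))⁻¹ ≤
      max (w b) (w (a + b)) * (w (a + b) * v b) := by
    have h := inv_le_max_rpow_mul (one_le_jap ((a : ℝ) + b)) (one_le_jap (b : ℝ)) hδ hδ1
    have h' := ENNReal.ofReal_le_ofReal h
    rw [ENNReal.ofReal_inv_of_pos (hpos _), ENNReal.ofReal_mul (le_max_of_le_left
      (Real.rpow_nonneg (hpos _).le _)), ENNReal.ofReal_mul (Real.rpow_nonneg (hpos _).le _),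
      ENNReal.ofReal_max, ← Int.cast_add] at h'
    rw [← Int.cast_add]
    exact h'
  have hweight (n : ℤ) : (v n * f₂ n) ^ 2 ≤
      ENNReal.ofReal (jap (n : ℝ) ^ (2 * ε)) * f₂ n ^ 2 := by
    rw [mul_pow, ← ENNReal.ofReal_pow (Real.rpow_nonneg (hpos _).le _),
      ← Real.rpow_mul_natCast (hpos _).le, mul_comm 2 ε]
    gcongr
    · exact one_le_jap _
    · norm_num
  calc ∑' p : ℤ × ℤ,
        f₁ p.1 * f₂ p.2 * f₃ (k - p.1 - p.2) / ENNReal.ofReal (jap ((p.1 : ℝ) + p.2))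
      ≤ ∑' p : ℤ × ℤ, (f₁ p.1 * max (w p.2) (w (p.1 + p.2))) *
          ((v p.2 * f₂ p.2) * w (p.1 + p.2)) * ⨆ k, f₃ k := by
        refine ENNReal.tsum_le_tsum fun p => ?_
        rw [div_eq_mul_inv]
        calc _ ≤ f₁ p.1 * f₂ p.2 * (⨆ k, f₃ k) *
              (max (w p.2) (w (p.1 + p.2)) * (w (p.1 + p.2) * v p.2)) := by
              gcongr
              · exact le_iSup f₃ _
              · exact hker _ _
          _ = _ := by ring
    _ ≤ 2 * (∑' n, w n ^ 2) * (∑' n, f₁ n ^ 2) ^ (1 / 2 : ℝ) *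
          (∑' n, (v n * f₂ n) ^ 2) ^ (1 / 2 : ℝ) * ⨆ k, f₃ k := by
        rw [ENNReal.tsum_mul_right]
        gcongr
        exact tsum_mul_max_mul_le w f₁ fun n => v n * f₂ n
    _ ≤ _ := by
        rw [hw, ENNReal.ofReal_mul two_pos.le, ENNReal.ofReal_ofNat]
        gcongr with n
        exact hweight n
end

section
/- Define a : ℤ → ℝ by a(k) := exp(−(log(1+|k|))^{4/3}). Then: (i) for every s ≥ 0, ∑_{k∈ℤ} (1+|k|)^{2s}·a(k)² < ∞ (so a belongs to H^s for every s, i.e. to H^∞); and (ii) for every real s ≥ 1 such that e^{s²} is an integer, (∑_{k∈ℤ} (1+|k|)^{2s}·a(k)²)^{1/2} ≥ e^{s³ − s^{8/3}}. Consequently, for every R > 0, sup_{s≥1} R^{−s²}·(∑_{k∈ℤ}(1+|k|)^{2s}a(k)²)^{1/2} = ∞. -/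
open scoped ENNReal

/-- The sequence `a(k) = exp(-(log⟨k⟩)^{4/3})`. -/
noncomputable def a19 (k : ℤ) : ℝ :=
  Real.exp (-(Real.log (1 + |(k : ℝ)|)) ^ ((4 : ℝ) / 3))

theorem weighted_a19_eq (s : ℝ) (k : ℤ) :
    (1 + |(k : ℝ)|) ^ (2 * s) * a19 k ^ 2 =
      Real.exp (2 * (s * Real.log (1 + |(k : ℝ)|) -
        Real.log (1 + |(k : ℝ)|) ^ ((4 : ℝ) / 3))) := by
  rw [a19, Real.rpow_def_of_pos (by positivity), ← Real.exp_nat_mul, ← Real.exp_add]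
  congr 1
  push_cast
  ring

theorem mul_le_pow_four_add_rpow {c x : ℝ} (hc : 0 ≤ c) (hx : 0 ≤ x) :
    c * x ≤ c ^ 4 + x ^ ((4 : ℝ) / 3) := by
  obtain ⟨t, ht, rfl⟩ : ∃ t : ℝ, 0 ≤ t ∧ t ^ 3 = x :=
    ⟨x ^ ((3 : ℕ) : ℝ)⁻¹, by positivity, Real.rpow_inv_natCast_pow hx (by norm_num)⟩
  have h4 : (t ^ 3) ^ ((4 : ℝ) / 3) = t ^ 4 := by
    rw [← Real.rpow_natCast, ← Real.rpow_mul ht, ← Real.rpow_natCast]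
    norm_num
  rw [h4]
  rcases le_total c t with h | h
  · calc c * t ^ 3 ≤ t * t ^ 3 := by gcongr
      _ = t ^ 4 := by ring
      _ ≤ c ^ 4 + t ^ 4 := by linarith [pow_nonneg hc 4]
  · calc c * t ^ 3 ≤ c * c ^ 3 := by gcongr
      _ = c ^ 4 := by ring
      _ ≤ c ^ 4 + t ^ 4 := by linarith [pow_nonneg ht 4]

theorem summable_one_add_abs_int_sq_inv :
    Summable fun k : ℤ => ((1 + |(k : ℝ)|) ^ 2)⁻¹ := by
  have h : Summable fun n : ℕ => ((1 + (n : ℝ)) ^ 2)⁻¹ := by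
    have := (summable_nat_add_iff 1).2 (Real.summable_nat_pow_inv.2 (by norm_num : 1 < 2))
    simpa [add_comm] using this
  refine Summable.of_nat_of_neg ?_ ?_ <;> simpa using h

theorem tsum_weighted_a19_lt_top (s : ℝ) (hs : 0 ≤ s) :
    (∑' k : ℤ, ENNReal.ofReal ((1 + |(k : ℝ)|) ^ (2 * s) * a19 k ^ 2)) < ⊤ := by
  refine (Summable.of_nonneg_of_le (fun k => by positivity) (fun k => ?_)
    (summable_one_add_abs_int_sq_inv.mul_left
      (Real.exp (2 * (s + 1) ^ 4)))).tsum_ofReal_lt_top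
  have hpos : 0 < 1 + |(k : ℝ)| := by positivity
  have hlog : 0 ≤ Real.log (1 + |(k : ℝ)|) :=
    Real.log_nonneg (by linarith [abs_nonneg (k : ℝ)])
  have hinv : ((1 + |(k : ℝ)|) ^ 2)⁻¹ = Real.exp (-(2 * Real.log (1 + |(k : ℝ)|))) := by
    rw [Real.exp_neg, mul_comm, Real.exp_mul, Real.exp_log hpos, Real.rpow_two]
  rw [weighted_a19_eq, hinv, ← Real.exp_add, Real.exp_le_exp]
  linarith [mul_le_pow_four_add_rpow (by linarith : 0 ≤ s + 1) hlog]

theorem exp_le_sobolev_norm_a19 (s : ℝ) (hs : 0 ≤ s)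
    (h : ∃ m : ℤ, Real.exp (s ^ 2) = (m : ℝ)) :
    ENNReal.ofReal (Real.exp (s ^ 3 - s ^ ((8 : ℝ) / 3))) ≤
      (∑' k : ℤ, ENNReal.ofReal ((1 + |(k : ℝ)|) ^ (2 * s) * a19 k ^ 2)) ^ (1 / 2 : ℝ) := by
  obtain ⟨m, hm⟩ := h
  have habs : 1 + |((m - 1 : ℤ) : ℝ)| = Real.exp (s ^ 2) := by
    have h1 : 1 ≤ Real.exp (s ^ 2) := Real.one_le_exp (by positivity)
    push_cast
    rw [← hm, abs_of_nonneg (by linarith)]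
    ring
  have hpow : (s ^ 2) ^ ((4 : ℝ) / 3) = s ^ ((8 : ℝ) / 3) := by
    rw [← Real.rpow_natCast, ← Real.rpow_mul hs]
    norm_num
  have hterm := ENNReal.le_tsum
    (f := fun k : ℤ => ENNReal.ofReal ((1 + |(k : ℝ)|) ^ (2 * s) * a19 k ^ 2)) (m - 1)
  refine le_trans (le_of_eq ?_) (ENNReal.rpow_le_rpow hterm (by norm_num))
  rw [weighted_a19_eq, habs, Real.log_exp, hpow,
    ENNReal.ofReal_rpow_of_pos (Real.exp_pos _), ← Real.exp_mul]
  ring_nf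

theorem exists_exp_sq_eq_int_le_exponent (l M : ℝ) :
    ∃ s : ℝ, 1 ≤ s ∧ (∃ m : ℤ, Real.exp (s ^ 2) = (m : ℝ)) ∧
      M ≤ s ^ 3 - s ^ ((8 : ℝ) / 3) - l * s ^ 2 := by
  set T : ℝ := 2 + |l| + |M| with hT
  have hT2 : 2 ≤ T := by linarith [abs_nonneg l, abs_nonneg M]
  obtain ⟨m, hm⟩ := exists_nat_ge (Real.exp ((T ^ 3) ^ 2))
  have hmpos : (0 : ℝ) < m := (Real.exp_pos _).trans_le hm
  have hlog : (T ^ 3) ^ 2 ≤ Real.log m := (Real.le_log_iff_exp_le hmpos).2 hm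
  obtain ⟨t, ht, hts⟩ : ∃ t : ℝ, 0 ≤ t ∧ t ^ 3 = √(Real.log m) :=
    ⟨√(Real.log m) ^ ((3 : ℕ) : ℝ)⁻¹, by positivity,
      Real.rpow_inv_natCast_pow (by positivity) (by norm_num)⟩
  have hTt : T ≤ t :=
    le_of_pow_le_pow_left₀ three_ne_zero ht (hts ▸ Real.le_sqrt_of_sq_le hlog)
  have h8 : (t ^ 3) ^ ((8 : ℝ) / 3) = t ^ 8 := by
    rw [← Real.rpow_natCast, ← Real.rpow_mul ht, ← Real.rpow_natCast]
    norm_num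
  refine ⟨t ^ 3, one_le_pow₀ (by linarith), ⟨m, ?_⟩, ?_⟩
  · rw [hts, Real.sq_sqrt ((by positivity : (0 : ℝ) ≤ (T ^ 3) ^ 2).trans hlog),
      Real.exp_log hmpos]
    simp
  · rw [h8]
    have hfac : |M| ≤ t ^ 3 - t ^ 2 - l := by
      nlinarith [le_abs_self l, mul_nonneg (by nlinarith : 0 ≤ t ^ 2 - 1)
        (by linarith : 0 ≤ t - 1)]
    calc M ≤ |M| := le_abs_self M
      _ ≤ t ^ 3 - t ^ 2 - l := hfac
      _ ≤ t ^ 6 * (t ^ 3 - t ^ 2 - l) :=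
        le_mul_of_one_le_left ((abs_nonneg M).trans hfac) (one_le_pow₀ (by linarith))
      _ = (t ^ 3) ^ 3 - t ^ 8 - l * (t ^ 3) ^ 2 := by ring

/-- `a19` is in `H^s` for every `s ≥ 0`, yet its `H^s` norms grow like `e^{s³-s^{8/3}}`
along `s` with `e^{s²} ∈ ℤ`; consequently `sup_{s≥1} R^{-s²}‖a19‖_{H^s} = ∞` for every `R > 0`. -/
theorem stmt19 :
    (∀ s : ℝ, 0 ≤ s →
      (∑' k : ℤ, ENNReal.ofReal ((1 + |(k : ℝ)|) ^ (2 * s) * a19 k ^ 2)) < ⊤) ∧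
    (∀ s : ℝ, 1 ≤ s → (∃ m : ℤ, Real.exp (s ^ 2) = (m : ℝ)) →
      ENNReal.ofReal (Real.exp (s ^ 3 - s ^ ((8 : ℝ) / 3))) ≤
        (∑' k : ℤ, ENNReal.ofReal ((1 + |(k : ℝ)|) ^ (2 * s) * a19 k ^ 2)) ^ (1 / 2 : ℝ)) ∧
    (∀ R : ℝ, 0 < R →
      (⨆ s ∈ Set.Ici (1 : ℝ),
        ENNReal.ofReal (R ^ (-(s ^ 2))) *
          (∑' k : ℤ, ENNReal.ofReal ((1 + |(k : ℝ)|) ^ (2 * s) * a19 k ^ 2)) ^ (1 / 2 : ℝ)) = ⊤) := by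
  refine ⟨tsum_weighted_a19_lt_top, fun s hs h => exp_le_sobolev_norm_a19 s (by linarith) h,
    fun R hR => ENNReal.eq_top_of_forall_nnreal_le fun M => ?_⟩
  obtain ⟨s, hs, hm, hM⟩ := exists_exp_sq_eq_int_le_exponent (Real.log R) M
  refine le_trans ?_ (le_iSup₂_of_le s hs
    (mul_le_mul_right (exp_le_sobolev_norm_a19 s (by linarith) hm) _))
  rw [← ENNReal.ofReal_mul (by positivity), Real.rpow_def_of_pos hR, ← Real.exp_add,
    ← ENNReal.ofReal_coe_nnreal]
  refine ENNReal.ofReal_le_ofReal ?_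
  have h := Real.add_one_le_exp (M : ℝ)
  have h' : Real.exp M ≤ Real.exp (Real.log R * -s ^ 2 + (s ^ 3 - s ^ ((8 : ℝ) / 3))) :=
    Real.exp_le_exp.2 (by linarith)
  linarith
end
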